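/- The shuffle product is well-defined on the prefix abstraction: if two sequences of letters (a₁,…,aₙ) and (b₁,…,bₘ) have the same prefix abstraction of order l (i.e., pref_l(a₁…aₙ) = pref_l(b₁…bₘ)), then for every word w, the sets of l-prefixes of their shuffles with w coincide: { pref_l(s) | s ∈ (a₁…aₙ) ⧢ w } = { pref_l(s) | s ∈ (b₁…bₘ) ⧢ w }. -/

import Mathlib

/-- Shuffle with synchronization: complementary heads may synchronize into `τ`. -/
def sh {Act : Type*} [DecidableEq Act] (τ : Act) (bar : Act → Act) :
    List Act → List Act → Set (List Act)
  | [], w' => {w'}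
  | w, [] => {w}
  | a :: u, b :: v =>
    (fun s => a :: s) '' sh τ bar u (b :: v) ∪
    (fun s => b :: s) '' sh τ bar (a :: u) v ∪
    (if b = bar a then (fun s => τ :: s) '' sh τ bar u v else ∅)

theorem sh_nil_right {Act : Type*} [DecidableEq Act] (τ : Act) (bar : Act → Act)
    (a : List Act) : sh τ bar a [] = {a} := by
  cases a <;> simp [sh]

theorem sh_nonempty {Act : Type*} [DecidableEq Act] (τ : Act) (bar : Act → Act)
    (a w : List Act) : ∃ s, s ∈ sh τ bar a w := by
  induction a with
  | nil => exact ⟨w, by simp [sh]⟩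
  | cons x u ih =>
    cases w with
    | nil => exact ⟨x :: u, by simp [sh]⟩
    | cons c v =>
      obtain ⟨s, hs⟩ := ih
      refine ⟨x :: s, ?_⟩
      rw [sh]
      exact Or.inl (Or.inl ⟨s, hs, rfl⟩)

theorem sh_prefix_sim {Act : Type*} [DecidableEq Act] (τ : Act) (bar : Act → Act) (l : ℕ) :
    ∀ a b w : List Act, a.take l = b.take l →
      ∀ s ∈ sh τ bar a w, ∃ t ∈ sh τ bar b w, t.take l = s.take l := by
  induction l with
  | zero =>
    intro a b w _ s _
    obtain ⟨t, ht⟩ := sh_nonempty τ bar b w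
    exact ⟨t, ht, by simp⟩
  | succ l ih =>
    intro a b w h s hs
    cases w with
    | nil =>
      rw [sh_nil_right] at hs
      rw [sh_nil_right]
      cases hs
      exact ⟨b, rfl, h.symm⟩
    | cons c w =>
      cases a with
      | nil =>
        cases b with
        | nil => exact ⟨s, hs, rfl⟩
        | cons y v => simp at h
      | cons x u =>
        cases b with
        | nil => simp at h
        | cons y v =>
          simp only [List.take_succ_cons, List.cons.injEq] at h
          obtain ⟨rfl, h⟩ := h
          have h' : (x :: u).take l = (x :: v).take l := by
            cases l with
            | zero => rfl
            | succ k =>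
              have hk := congrArg (List.take k) h
              simp only [List.take_take] at hk
              simpa using hk
          rw [sh] at hs
          rw [sh]
          rcases hs with (⟨s, hs, rfl⟩ | ⟨s, hs, rfl⟩) | hs
          · obtain ⟨t, ht, e⟩ := ih u v (c :: w) h s hs
            exact ⟨x :: t, Or.inl (Or.inl ⟨t, ht, rfl⟩), by simp [e]⟩
          · obtain ⟨t, ht, e⟩ := ih _ _ w h' s hs
            exact ⟨c :: t, Or.inl (Or.inr ⟨t, ht, rfl⟩), by simp [e]⟩
          · by_cases hc : c = bar x
            · rw [if_pos hc] at hs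
              rw [if_pos hc]
              obtain ⟨s, hs, rfl⟩ := hs
              obtain ⟨t, ht, e⟩ := ih u v w h s hs
              exact ⟨τ :: t, Or.inr ⟨t, ht, rfl⟩, by simp [e]⟩
            · rw [if_neg hc] at hs
              exact hs.elim

theorem shuffle_well_defined_prefix {Act : Type*} [DecidableEq Act] (τ : Act)
    (bar : Act → Act) (hinv : ∀ a, bar (bar a) = a) (l : ℕ) (a b w : List Act)
    (h : a.take l = b.take l) :
    (fun s => s.take l) '' sh τ bar a w = (fun s => s.take l) '' sh τ bar b w := by
  apply Set.Subset.antisymm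
  · rintro _ ⟨s, hs, rfl⟩
    exact sh_prefix_sim τ bar l a b w h s hs
  · rintro _ ⟨s, hs, rfl⟩
    exact sh_prefix_sim τ bar l b a w h.symm s hs
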